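/- Divergence identity for the quotient field (identity (divpsi)): Let E = EuclideanSpace ℝ (Fin n), let p > 1 be real, and let x ∈ E. Let ψ : E → ℝ be differentiable on a neighborhood of x with ψ(x) > 0, and suppose the field Y := fun y => ‖∇ψ y‖^(p−2) • ∇ψ y is differentiable at x. Then the field X := fun y => −(ψ y)^(1−p) • Y y is differentiable at x, and div X x = − (div Y x) / (ψ x)^(p−1) + (p − 1) · ‖∇ψ x‖^p / (ψ x)^p. -/

import Mathlib

open RealInnerProductSpace MeasureTheory

/-- The divergence of a vector field: the trace of its Fréchet derivative. -/
noncomputable def vdiv {n : ℕ} (X : EuclideanSpace ℝ (Fin n) → EuclideanSpace ℝ (Fin n))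
    (x : EuclideanSpace ℝ (Fin n)) : ℝ :=
  LinearMap.trace ℝ (EuclideanSpace ℝ (Fin n)) (fderiv ℝ X x).toLinearMap

/-- The product rule for the divergence of a scalar multiple of a vector field. -/
theorem vdiv_smul {n : ℕ} {c : EuclideanSpace ℝ (Fin n) → ℝ}
    {Y : EuclideanSpace ℝ (Fin n) → EuclideanSpace ℝ (Fin n)} {x : EuclideanSpace ℝ (Fin n)}
    (hc : DifferentiableAt ℝ c x) (hY : DifferentiableAt ℝ Y x) :
    vdiv (fun y => c y • Y y) x = c x * vdiv Y x + fderiv ℝ c x (Y x) := by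
  have htrace : LinearMap.trace ℝ (EuclideanSpace ℝ (Fin n))
      ((fderiv ℝ c x).smulRight (Y x)).toLinearMap = fderiv ℝ c x (Y x) :=
    LinearMap.trace_smulRight (fderiv ℝ c x).toLinearMap (Y x)
  rw [vdiv, fderiv_fun_smul hc hY, ContinuousLinearMap.toLinearMap_add, map_add,
    ContinuousLinearMap.toLinearMap_smul, map_smul, htrace, smul_eq_mul, vdiv]

/-- The derivative of a function along `‖∇ψ‖ ^ (p - 2) • ∇ψ` is `‖∇ψ‖ ^ p`. -/
theorem fderiv_apply_rpow_norm_smul_gradient {n : ℕ} {p : ℝ} (hp : p ≠ 0)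
    (ψ : EuclideanSpace ℝ (Fin n) → ℝ) (x : EuclideanSpace ℝ (Fin n)) :
    fderiv ℝ ψ x (‖gradient ψ x‖ ^ (p - 2) • gradient ψ x) = ‖gradient ψ x‖ ^ p := by
  have hinner : fderiv ℝ ψ x (gradient ψ x) = ‖gradient ψ x‖ ^ 2 := by
    rw [← real_inner_self_eq_norm_sq]
    conv_rhs => rw [gradient, InnerProductSpace.toDual_symm_apply]
    rfl
  rw [map_smul, hinner, smul_eq_mul, ← Real.rpow_natCast,
    ← Real.rpow_add' (norm_nonneg _) (by simpa using hp)]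
  norm_num

/-- Divergence identity for the quotient field (identity (divpsi)). -/
theorem divergence_quotient_field (n : ℕ) (p : ℝ) (hp : 1 < p)
    (x : EuclideanSpace ℝ (Fin n))
    (ψ : EuclideanSpace ℝ (Fin n) → ℝ)
    (hψ : ∀ᶠ y in nhds x, DifferentiableAt ℝ ψ y) (hψx : 0 < ψ x)
    (Y : EuclideanSpace ℝ (Fin n) → EuclideanSpace ℝ (Fin n))
    (hY : Y = fun y => ‖gradient ψ y‖ ^ (p - 2) • gradient ψ y)
    (hYdiff : DifferentiableAt ℝ Y x) :
    DifferentiableAt ℝ (fun y => -((ψ y) ^ (1 - p)) • Y y) x ∧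
      vdiv (fun y => -((ψ y) ^ (1 - p)) • Y y) x =
        -(vdiv Y x) / (ψ x) ^ (p - 1) + (p - 1) * ‖gradient ψ x‖ ^ p / (ψ x) ^ p := by
  have hψd : DifferentiableAt ℝ ψ x := hψ.self_of_nhds
  have hc : HasFDerivAt (fun y => -((ψ y) ^ (1 - p)))
      (-(((1 - p) * (ψ x) ^ (1 - p - 1)) • fderiv ℝ ψ x)) x :=
    (hψd.hasFDerivAt.rpow_const (Or.inl hψx.ne')).neg
  refine ⟨hc.differentiableAt.smul hYdiff, ?_⟩
  have hYψ : fderiv ℝ ψ x (Y x) = ‖gradient ψ x‖ ^ p := by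
    rw [hY]
    exact fderiv_apply_rpow_norm_smul_gradient (by linarith) ψ x
  rw [vdiv_smul hc.differentiableAt hYdiff, hc.fderiv, neg_apply,
    smul_apply, hYψ, smul_eq_mul, show 1 - p - 1 = -p by ring,
    show 1 - p = -(p - 1) by ring, Real.rpow_neg hψx.le, Real.rpow_neg hψx.le]
  ring
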